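/- Let 𝒦 = (K,𝒜) be a system of isometries with associated ℝ-tree T_𝒦, and let wᵢ denote the prefix of length i of a reduced word w ∈ F(𝒜). Then: (a) for every non-admissible word w ∈ F(𝒜), the segment [K,wK] joining the disjoint subtrees K and wK intersects wᵢK for every prefix wᵢ of w; (b) for every point Q ∈ K and every (possibly admissible) word w ∈ F(𝒜), the segment [Q,wK] intersects wᵢK for every prefix wᵢ of w. -/

import Mathlib

/-!
Common formalization framework for "ℝ-trees, dual laminations, and compact systems
of partial isometries" (Coulbois–Hilion–Lustig).
-/

open Set Filter Topology Pointwise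

noncomputable section

namespace CHL

/-! ### ℝ-trees -/

/-- The metric betweenness segment `[x,y]`.  In an ℝ-tree this is exactly the unique
topological arc joining `x` to `y`, which is a geodesic segment. -/
def seg {T : Type*} [MetricSpace T] (x y : T) : Set T :=
  {z | dist x z + dist z y = dist x y}

/-- An ℝ-tree: a geodesic metric space which is `0`-hyperbolic (four point condition).
Equivalently, any two points are joined by a unique topological arc, and this arc is a
geodesic segment. -/
class IsRTree (T : Type*) [MetricSpace T] : Prop where
  geodesic : ∀ x y : T, ∃ f : ℝ → T, f 0 = x ∧ f (dist x y) = y ∧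
      ∀ s ∈ Set.Icc (0 : ℝ) (dist x y), ∀ t ∈ Set.Icc (0 : ℝ) (dist x y),
        dist (f s) (f t) = |s - t|
  four_point : ∀ x y z w : T,
      dist x y + dist z w ≤ max (dist x z + dist y w) (dist x w + dist y z)

/-- A subtree of an ℝ-tree: a convex subset. -/
def IsSubtree {T : Type*} [MetricSpace T] (A : Set T) : Prop :=
  ∀ x ∈ A, ∀ y ∈ A, seg x y ⊆ A

/-- A non-empty closed subtree. -/
def IsClosedSubtree {T : Type*} [MetricSpace T] (A : Set T) : Prop :=
  A.Nonempty ∧ IsClosed A ∧ IsSubtree A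

/-- The convex hull of a subset of an ℝ-tree: the smallest subtree containing it. -/
def subtreeHull {T : Type*} [MetricSpace T] (S : Set T) : Set T :=
  ⋂₀ {A : Set T | S ⊆ A ∧ IsSubtree A}

/-- A finite tree: the convex hull of finitely many points. -/
def IsFiniteSubtree {T : Type*} [MetricSpace T] (A : Set T) : Prop :=
  ∃ F : Finset T, A = subtreeHull (F : Set T)

/-- `[x,x']` is the segment joining `A` to `B`: its endpoints are the only points
in `A` resp. `B` that it meets. -/
def IsBridge {T : Type*} [MetricSpace T] (A B : Set T) (x x' : T) : Prop :=
  x ∈ A ∧ x' ∈ B ∧ seg x x' ∩ A = {x} ∧ seg x x' ∩ B = {x'}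

/-- A morphism of ℝ-trees: a continuous map such that every segment is mapped locally
injectively except at finitely many points. -/
def IsTreeMorphism {T T' : Type*} [MetricSpace T] [MetricSpace T'] (f : T → T') : Prop :=
  Continuous f ∧ ∀ x y : T, ∃ F : Finset T, ∀ p ∈ seg x y, p ∉ (F : Set T) →
    ∃ U ∈ nhdsWithin p (seg x y), Set.InjOn f U

/-- The translation length `‖g‖_T = inf_{x ∈ T} d(x, gx)`. -/
def translationLength (G : Type*) [Group G] (T : Type*) [MetricSpace T] [MulAction G T]
    (g : G) : ℝ :=
  ⨅ x : T, dist x (g • x)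

/-- The translation length of `g` on an invariant subtree `A`. -/
def translationLengthOn {G : Type*} [Group G] {T : Type*} [MetricSpace T] [MulAction G T]
    (A : Set T) (g : G) : ℝ :=
  ⨅ x : A, dist (x : T) (g • (x : T))

/-- The minimal `G`-invariant subtree. -/
def minSubtree (G : Type*) [Group G] (T : Type*) [MetricSpace T] [MulAction G T] : Set T :=
  ⋂₀ {A : Set T | A.Nonempty ∧ IsSubtree A ∧ ∀ g : G, ∀ x ∈ A, g • x ∈ A}

/-! ### Free groups, reduced words and the boundary `∂F(𝒜)` -/

/-- Two letters of `𝒜^{±1}` are inverse to each other. -/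
def LettersInv {ι : Type*} (a b : ι × Bool) : Prop := a.1 = b.1 ∧ a.2 = !b.2

/-- The prefix of length `n` of (the reduced word of) `w`. -/
def gprefix {ι : Type*} [DecidableEq ι] (w : FreeGroup ι) (n : ℕ) : FreeGroup ι :=
  FreeGroup.mk (w.toWord.take n)

/-- An infinite reduced word in the letters `𝒜^{±1}`: a point of the Gromov boundary
`∂F(𝒜)` of the free group `F(𝒜)`. -/
structure InfWord (ι : Type*) where
  letter : ℕ → ι × Bool
  reduced : ∀ n, ¬ LettersInv (letter n) (letter (n + 1))

/-- The prefix `X_n` of length `n` of an infinite reduced word `X`. -/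
def InfWord.prefixN {ι : Type*} (X : InfWord ι) (n : ℕ) : FreeGroup ι :=
  FreeGroup.mk (List.ofFn fun i : Fin n => X.letter i)

/-- The infinite word `X_k⁻¹ X` obtained by deleting the first `k` letters. -/
def InfWord.shift {ι : Type*} (X : InfWord ι) (k : ℕ) : InfWord ι :=
  ⟨fun n => X.letter (k + n), fun n => X.reduced (k + n)⟩

/-- A sequence `wₙ ∈ F(𝒜)` converges in `F(𝒜) ∪ ∂F(𝒜)` to the infinite word `X` iff
the length of the maximal common prefix of `wₙ` and `X` tends to infinity. -/
def TendstoBoundary {ι : Type*} [DecidableEq ι] (w : ℕ → FreeGroup ι) (X : InfWord ι) : Prop :=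
  ∀ k : ℕ, ∀ᶠ n in atTop, (w n).toWord.take k = List.ofFn fun i : Fin k => X.letter i

/-- `Y = w · X` for the left action of `F(𝒜)` on its boundary `∂F(𝒜)`. -/
def SmulBoundary {ι : Type*} [DecidableEq ι] (w : FreeGroup ι) (X Y : InfWord ι) : Prop :=
  TendstoBoundary (fun n => w * X.prefixN n) Y

/-- The (Cantor set) topology on `∂F(𝒜)`, induced by the product topology on sequences
of letters. -/
instance {ι : Type*} : TopologicalSpace (InfWord ι) :=
  TopologicalSpace.induced (fun X => X.letter)
    (@Pi.topologicalSpace ℕ (fun _ => ι × Bool) fun _ => ⊥)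

/-- A non-trivial element of `F(𝒜)` is cyclically reduced if the first letter of its reduced
word is not the inverse of its last letter. -/
def IsCyclicallyReduced {ι : Type*} [DecidableEq ι] (w : FreeGroup ι) : Prop :=
  w ≠ 1 ∧ ∀ a ∈ w.toWord.head?, ∀ b ∈ w.toWord.getLast?, ¬ LettersInv a b

/-- The dual laminary language `ℒ_𝒜(T)` of an isometric action of `F(𝒜)` on `T`. -/
def dualLanguage (ι : Type*) [DecidableEq ι] (T : Type*) [MetricSpace T]
    [MulAction (FreeGroup ι) T] : Set (FreeGroup ι) :=
  {v | ∀ ε > (0 : ℝ), ∃ u w : FreeGroup ι,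
      (u * v * w).toWord = u.toWord ++ v.toWord ++ w.toWord ∧
      IsCyclicallyReduced (u * v * w) ∧
      translationLength (FreeGroup ι) T (u * v * w) < ε}

/-- The dual laminary language `ℒ_𝒜(T)`, for the action restricted to an invariant
subtree `A`. -/
def dualLanguageOn (ι : Type*) [DecidableEq ι] {T : Type*} [MetricSpace T]
    [MulAction (FreeGroup ι) T] (A : Set T) : Set (FreeGroup ι) :=
  {v | ∀ ε > (0 : ℝ), ∃ u w : FreeGroup ι,
      (u * v * w).toWord = u.toWord ++ v.toWord ++ w.toWord ∧
      IsCyclicallyReduced (u * v * w) ∧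
      translationLengthOn A (u * v * w) < ε}

/-! ### Systems of isometries on a compact ℝ-tree -/

/-- A system of isometries `𝒦 = (K, 𝒜)`: a family, indexed by `ι`, of non-empty partial
isometries of the compact ℝ-tree `K`, i.e. isometries between non-empty closed subtrees. -/
structure SystemOfIsometries (K : Type*) [MetricSpace K] (ι : Type*) where
  pe : ι → PartialEquiv K K
  isom : ∀ i, ∀ x ∈ (pe i).source, ∀ y ∈ (pe i).source, dist (pe i x) (pe i y) = dist x y
  source_subtree : ∀ i, IsClosedSubtree (pe i).source
  target_subtree : ∀ i, IsClosedSubtree (pe i).target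

namespace SystemOfIsometries

variable {K : Type*} [MetricSpace K] {ι : Type*} (S : SystemOfIsometries K ι)

/-- The partial isometry associated to a letter in `𝒜^{±1}`. -/
def letterPE : ι × Bool → PartialEquiv K K
  | (i, true) => S.pe i
  | (i, false) => (S.pe i).symm

/-- The partial isometry `z₁ ∘ z₂ ∘ ⋯ ∘ zₙ` (acting on the right: first `z₁`, then `z₂`, …)
associated to the reduced word `w = z₁ ⋯ zₙ ∈ F(𝒜)`. -/
def wordPE [DecidableEq ι] (w : FreeGroup ι) : PartialEquiv K K :=
  (w.toWord.map S.letterPE).foldl PartialEquiv.trans (PartialEquiv.refl K)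

/-- The domain `dom (w)` of the partial isometry associated to `w`. -/
def dom [DecidableEq ι] (w : FreeGroup ι) : Set K := (S.wordPE w).source

/-- A word is admissible if it is non-empty as a partial isometry of `K`. -/
def Admissible [DecidableEq ι] (w : FreeGroup ι) : Prop := (S.dom w).Nonempty

/-- An infinite word is admissible if all its prefixes are admissible. -/
def AdmissibleInf [DecidableEq ι] (X : InfWord ι) : Prop := ∀ n, S.Admissible (X.prefixN n)

/-- The domain of an infinite word: the intersection of the domains of its prefixes. -/
def domInf [DecidableEq ι] (X : InfWord ι) : Set K := ⋂ n, S.dom (X.prefixN n)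

/-- An infinite word `X` is eventually admissible if some suffix `X_k⁻¹ X` is admissible. -/
def EventuallyAdmissible [DecidableEq ι] (X : InfWord ι) : Prop :=
  ∃ k, S.AdmissibleInf (X.shift k)

/-- The system `𝒦` has independent generators if the (non-empty) domain of every
admissible infinite word consists of exactly one point. -/
def IndependentGenerators [DecidableEq ι] : Prop :=
  ∀ X : InfWord ι, S.AdmissibleInf X → ∃ x : K, S.domInf X = {x}

/-- The admissible laminary language `ℒ_adm(𝒦)`: the largest laminary language consisting of
admissible words; `w ∈ ℒ_adm(𝒦)` iff for every `k` the word `w` is obtained from some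
admissible word `v` by deleting its prefix and its suffix of length `k`. -/
def admLanguage [DecidableEq ι] : Set (FreeGroup ι) :=
  {w | ∀ k : ℕ, ∃ v : FreeGroup ι, S.Admissible v ∧
      ∃ p s : List (ι × Bool), p.length = k ∧ s.length = k ∧
        v.toWord = p ++ w.toWord ++ s}

end SystemOfIsometries

/-- The ℝ-tree `T_𝒦` associated to a system of isometries `𝒦 = (K, 𝒜)`, presented through
its characteristic properties (Theorem 3.2 of the paper, by which it is unique):
`T_𝒦` contains `K` as an isometrically embedded subtree (1); the left action of `F(𝒜)`
is compatible with the partial isometries (2); every orbit meets `K`, and indeed every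
segment is covered by finitely many translates of `K` (3); and `T_𝒦` is universal among
trees satisfying (1) and (2), via unique equivariant morphisms (4). -/
structure AssocTree {K : Type} [MetricSpace K] {ι : Type} [DecidableEq ι]
    (S : SystemOfIsometries K ι) where
  carrier : Type
  [ms : MetricSpace carrier]
  tree : IsRTree carrier
  [act : MulAction (FreeGroup ι) carrier]
  act_isom : ∀ g : FreeGroup ι, Isometry fun x : carrier => g • x
  emb : K → carrier
  emb_isom : Isometry emb
  emb_subtree : IsSubtree (Set.range emb)
  compat : ∀ i : ι, ∀ x ∈ (S.pe i).source, (FreeGroup.of i)⁻¹ • emb x = emb (S.pe i x)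
  orbit_meets : ∀ p : carrier, ∃ (w : FreeGroup ι) (x : K), p = w • emb x
  seg_cover : ∀ p q : carrier, ∃ F : Finset (FreeGroup ι),
      seg p q ⊆ ⋃ w ∈ F, w • Set.range emb
  universal : ∀ (T' : Type) [MetricSpace T'] [MulAction (FreeGroup ι) T'],
      (∀ g : FreeGroup ι, Isometry fun x : T' => g • x) →
      ∀ e' : K → T', Isometry e' →
      (∀ i : ι, ∀ x ∈ (S.pe i).source, (FreeGroup.of i)⁻¹ • e' x = e' (S.pe i x)) →
      ∃! f : carrier → T', IsTreeMorphism f ∧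
        (∀ (g : FreeGroup ι) (p : carrier), f (g • p) = g • f p) ∧
        ∀ x : K, f (emb x) = e' x

attribute [instance] AssocTree.ms AssocTree.act

/-! ### Very small minimal actions with dense orbits, and their metric completion -/

/-- An ℝ-tree `T` (here: the subtree `Tsub` of the complete ℝ-tree `Tb`, whose metric
completion `T̄` is `Tb`) with a very small, minimal, isometric action of the free group
`F(𝒜)` with dense orbits.  (For actions with dense orbits, "very small" is equivalent to
"trivial arc stabilizers".) -/
structure TreeSetup (ι : Type) where
  Tb : Type
  [ms : MetricSpace Tb]
  complete : CompleteSpace Tb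
  tree : IsRTree Tb
  [act : MulAction (FreeGroup ι) Tb]
  act_isom : ∀ g : FreeGroup ι, Isometry fun x : Tb => g • x
  Tsub : Set Tb
  nonempty : Tsub.Nonempty
  dense : Dense Tsub
  sub_subtree : IsSubtree Tsub
  invariant : ∀ g : FreeGroup ι, ∀ x ∈ Tsub, g • x ∈ Tsub
  minimal : ∀ A : Set Tb, A ⊆ Tsub → A.Nonempty → IsSubtree A →
      (∀ g : FreeGroup ι, ∀ x ∈ A, g • x ∈ A) → A = Tsub
  dense_orbits : ∀ x ∈ Tsub, Tsub ⊆ closure (Set.range fun g : FreeGroup ι => g • x)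
  arc_stab : ∀ g : FreeGroup ι, ∀ x ∈ Tsub, ∀ y ∈ Tsub, x ≠ y →
      (fun p => g • p) '' seg x y = seg x y → g = 1

attribute [instance] TreeSetup.ms TreeSetup.act

/-- `𝒬(X) = Q` (for `Q ∈ T̄`), where `𝒬 : ∂F_N → T̂` is the map of Levitt–Lustig:
it is characterized by the property that whenever a sequence `uₙ ∈ F_N` converges to
`X ∈ ∂F_N` and `uₙ P` converges metrically in `T̄` to a point `Q`, then `𝒬(X) = Q`. -/
def QRel {ι : Type} [DecidableEq ι] (St : TreeSetup ι) (X : InfWord ι) (Q : St.Tb) : Prop :=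
  ∃ P ∈ St.Tsub, ∃ u : ℕ → FreeGroup ι, TendstoBoundary u X ∧
    Tendsto (fun n => u n • P) atTop (𝓝 Q)

/-- The limit set `Ω_𝒜 = 𝒬²(C²_𝒜 ∩ L²(T)) ⊆ T̄`: images of pairs of distinct boundary
points with distinct first letters (w.r.t. the basis `𝒜`) that are identified by `𝒬`. -/
def limitSet {ι : Type} [DecidableEq ι] (St : TreeSetup ι) : Set St.Tb :=
  {Q | ∃ X Y : InfWord ι, X.letter 0 ≠ Y.letter 0 ∧ QRel St X Q ∧ QRel St Y Q}

/-- The heart `K_𝒜 ⊆ T̄`: the convex hull of the limit set `Ω_𝒜`. -/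
def heart {ι : Type} [DecidableEq ι] (St : TreeSetup ι) : Set St.Tb :=
  subtreeHull (limitSet St)

/-- The dual algebraic lamination `L²(T) = {(X,Y) ∈ ∂²F_N : 𝒬(X) = 𝒬(Y)}`. -/
def L2 {ι : Type} [DecidableEq ι] (St : TreeSetup ι) : Set (InfWord ι × InfWord ι) :=
  {p | p.1 ≠ p.2 ∧ ∃ Q : St.Tb, QRel St p.1 Q ∧ QRel St p.2 Q}

/-! ### The system of isometries induced on a compact subtree `K ⊆ T̄` -/

/-- The domain, inside `T̄`, of the partial isometry `x ↦ w⁻¹ x` of `K` induced by the word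
`w`: the intersection of the translates of `K` by the prefixes of `w`. -/
def inducedDom {ι : Type} [DecidableEq ι] (St : TreeSetup ι) (K : Set St.Tb)
    (w : FreeGroup ι) : Set St.Tb :=
  ⋂ n ∈ Finset.range (w.toWord.length + 1), gprefix w n • K

/-- Admissibility of a word for the induced system of isometries `𝒦 = (K, 𝒜)`. -/
def InducedAdmissible {ι : Type} [DecidableEq ι] (St : TreeSetup ι) (K : Set St.Tb)
    (w : FreeGroup ι) : Prop :=
  (inducedDom St K w).Nonempty

/-- The admissible laminary language `ℒ_adm(𝒦)` of the induced system `𝒦 = (K, 𝒜)`. -/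
def inducedAdmLanguage {ι : Type} [DecidableEq ι] (St : TreeSetup ι) (K : Set St.Tb) :
    Set (FreeGroup ι) :=
  {w | ∀ k : ℕ, ∃ v : FreeGroup ι, InducedAdmissible St K v ∧
      ∃ p s : List (ι × Bool), p.length = k ∧ s.length = k ∧
        v.toWord = p ++ w.toWord ++ s}

/-- Admissibility of an infinite word for the induced system `𝒦 = (K, 𝒜)`. -/
def InducedAdmissibleInf {ι : Type} [DecidableEq ι] (St : TreeSetup ι) (K : Set St.Tb)
    (X : InfWord ι) : Prop :=
  ∀ n, InducedAdmissible St K (X.prefixN n)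

/-- The domain `dom(X) = ⋂ₙ dom(Xₙ)` of an infinite word, for the induced system. -/
def inducedDomInf {ι : Type} [DecidableEq ι] (St : TreeSetup ι) (K : Set St.Tb)
    (X : InfWord ι) : Set St.Tb :=
  ⋂ n, X.prefixN n • K

/-- Compatibility of a map `e : K → T'` with the system of partial isometries induced on
`K ⊆ T̄` by the basis `𝒜`: this is condition (2) of Theorem 3.2 for the induced system. -/
def InducedCompat {ι : Type} (St : TreeSetup ι) (K : Set St.Tb) {T' : Type} [MetricSpace T']
    [MulAction (FreeGroup ι) T'] (e : K → T') : Prop :=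
  ∀ (i : ι) (x : K) (h : (FreeGroup.of i)⁻¹ • (x : St.Tb) ∈ K),
    (FreeGroup.of i)⁻¹ • e x = e ⟨(FreeGroup.of i)⁻¹ • (x : St.Tb), h⟩

/-- The tree `T_𝒦` associated to the system of isometries induced on a compact subtree
`K ⊆ T̄`, presented through the characteristic properties of Theorem 3.2 (by which it is
unique), together with the canonical `F(𝒜)`-equivariant morphism `j : T_𝒦 → T̄` restricting
to the identity on `K`. -/
structure InducedAssoc {ι : Type} (St : TreeSetup ι) (K : Set St.Tb) where
  TK : Type
  [ms : MetricSpace TK]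
  tree : IsRTree TK
  [act : MulAction (FreeGroup ι) TK]
  act_isom : ∀ g : FreeGroup ι, Isometry fun x : TK => g • x
  emb : K → TK
  emb_isom : Isometry emb
  emb_subtree : IsSubtree (Set.range emb)
  compat : InducedCompat St K emb
  orbit_meets : ∀ p : TK, ∃ (w : FreeGroup ι) (x : K), p = w • emb x
  seg_cover : ∀ p q : TK, ∃ F : Finset (FreeGroup ι),
      seg p q ⊆ ⋃ w ∈ F, w • Set.range emb
  universal : ∀ (T' : Type) [MetricSpace T'] [MulAction (FreeGroup ι) T'],
      (∀ g : FreeGroup ι, Isometry fun x : T' => g • x) →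
      ∀ e' : K → T', Isometry e' → InducedCompat St K e' →
      ∃! f : TK → T', IsTreeMorphism f ∧
        (∀ (g : FreeGroup ι) (p : TK), f (g • p) = g • f p) ∧
        ∀ x : K, f (emb x) = e' x
  jmap : TK → St.Tb
  jmap_morphism : IsTreeMorphism jmap
  jmap_equivariant : ∀ (g : FreeGroup ι) (p : TK), jmap (g • p) = g • jmap p
  jmap_emb : ∀ x : K, jmap (emb x) = (x : St.Tb)

attribute [instance] InducedAssoc.ms InducedAssoc.act

/-! ### Change of basis -/

/-- Changing the basis of the free group: the same tree, with the action precomposed with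
the automorphism `φ` of `F(𝒜)`.  The heart of `St.twist φ` is the heart of `T` with respect
to the basis `φ(𝒜)`. -/
def TreeSetup.twist {ι : Type} (St : TreeSetup ι) (φ : FreeGroup ι ≃* FreeGroup ι) :
    TreeSetup ι where
  Tb := St.Tb
  ms := St.ms
  complete := St.complete
  tree := St.tree
  act := { smul := fun g x => φ g • x
           one_smul := fun x => by show φ 1 • x = x; rw [map_one, one_smul]
           mul_smul := fun g h x => by
             show φ (g * h) • x = φ g • φ h • x
             rw [map_mul, mul_smul] }
  act_isom := fun g => St.act_isom (φ g)
  Tsub := St.Tsub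
  nonempty := St.nonempty
  dense := St.dense
  sub_subtree := St.sub_subtree
  invariant := fun g x hx => St.invariant (φ g) x hx
  minimal := fun A hA hne hsub hinv => St.minimal A hA hne hsub (fun g x hx => by
    have h : φ (φ.symm g) • x ∈ A := hinv (φ.symm g) x hx
    rwa [MulEquiv.apply_symm_apply] at h)
  dense_orbits := fun x hx => by
    have hr : (Set.range fun g : FreeGroup ι => φ g • x) =
        Set.range fun g : FreeGroup ι => g • x := by
      apply Set.ext; intro y
      constructor
      · rintro ⟨g, rfl⟩; exact ⟨φ g, rfl⟩
      · rintro ⟨g, rfl⟩; exact ⟨φ.symm g, by simp⟩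
    show St.Tsub ⊆ closure (Set.range fun g : FreeGroup ι => φ g • x)
    rw [hr]; exact St.dense_orbits x hx
  arc_stab := fun g x hx y hy hxy him => by
    have h1 : φ g = 1 := St.arc_stab (φ g) x hx y hy hxy him
    have h2 := congrArg φ.symm h1
    simpa using h2

/-! ### The boundary `∂T`, the space `T̂ = T̄ ∪ ∂T` and the observers' topology -/

/-- An isometric ray (parametrized on `[0,∞)`) in a metric space. -/
def IsRay {T : Type} [MetricSpace T] (r : ℝ → T) : Prop :=
  ∀ s t : ℝ, 0 ≤ s → 0 ≤ t → dist (r s) (r t) = |s - t|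

/-- The type of isometric rays in `T`. -/
def Ray (T : Type) [MetricSpace T] : Type := {r : ℝ → T // IsRay r}

/-- Two rays define the same end iff they are at bounded distance. -/
def rayEnd (T : Type) [MetricSpace T] : Setoid (Ray T) where
  r := fun r₁ r₂ => ∃ C : ℝ, ∀ t : ℝ, 0 ≤ t → dist (r₁.1 t) (r₂.1 t) ≤ C
  iseqv := by
    refine ⟨fun r => ⟨0, fun t _ => by simp⟩, ?_, ?_⟩
    · rintro r₁ r₂ ⟨C, hC⟩
      exact ⟨C, fun t ht => by rw [dist_comm]; exact hC t ht⟩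
    · rintro r₁ r₂ r₃ ⟨C, hC⟩ ⟨D, hD⟩
      exact ⟨C + D, fun t ht =>
        (dist_triangle _ (r₂.1 t) _).trans (add_le_add (hC t ht) (hD t ht))⟩

/-- The Gromov boundary `∂T`: ends of `T`, i.e. classes of rays at bounded distance. -/
def GromovBoundary (T : Type) [MetricSpace T] : Type := Quotient (rayEnd T)

/-- The space `T̂ = T̄ ∪ ∂T` (for `T` a complete ℝ-tree, representing the completion `T̄`). -/
def TreeHat (T : Type) [MetricSpace T] : Type := T ⊕ GromovBoundary T

/-- The segment `[x, ξ]` from a point `x ∈ T̄` to a boundary point `ξ ∈ ∂T`. -/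
def raySeg {T : Type} [MetricSpace T] (x : T) (ξ : GromovBoundary T) : Set (TreeHat T) :=
  ({Sum.inr ξ} : Set (TreeHat T)) ∪ Sum.inl ''
    {p | ∃ r : Ray T, Quotient.mk (rayEnd T) r = ξ ∧ r.1 0 = x ∧ ∃ t : ℝ, 0 ≤ t ∧ r.1 t = p}

/-- The segment `[ξ, η]` between two boundary points. -/
def lineSeg {T : Type} [MetricSpace T] (ξ η : GromovBoundary T) : Set (TreeHat T) :=
  ({Sum.inr ξ, Sum.inr η} : Set (TreeHat T)) ∪ Sum.inl ''
    {p | ∃ r r' : Ray T, Quotient.mk (rayEnd T) r = ξ ∧ Quotient.mk (rayEnd T) r' = η ∧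
      r.1 0 = p ∧ r'.1 0 = p ∧ ∀ s t : ℝ, 0 ≤ s → 0 ≤ t → dist (r.1 s) (r'.1 t) = s + t}

/-- The segment `[P, Q]` between two points of `T̂ = T̄ ∪ ∂T`. -/
def segHat {T : Type} [MetricSpace T] : TreeHat T → TreeHat T → Set (TreeHat T)
  | Sum.inl x, Sum.inl y => Sum.inl '' seg x y
  | Sum.inl x, Sum.inr ξ => raySeg x ξ
  | Sum.inr ξ, Sum.inl x => raySeg x ξ
  | Sum.inr ξ, Sum.inr η => lineSeg ξ η

/-- The observers' topology on `T̂`: generated by the set of directions, where the direction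
at `P` containing `x` is the set of points `y` with `P ∉ [x,y]` (i.e. the connected component
of `T̂ ∖ {P}` containing `x`). -/
def observersTopology (T : Type) [MetricSpace T] : TopologicalSpace (TreeHat T) :=
  TopologicalSpace.generateFrom
    {D | ∃ P x : TreeHat T, x ≠ P ∧ D = {y | y ≠ P ∧ P ∉ segHat x y}}

/-- The extension to `T̂ = T̄ ∪ ∂T` of an isometric action on `T̄`. -/
def TreeHat.smul {T : Type} [MetricSpace T] {G : Type} [Group G] [MulAction G T]
    (hiso : ∀ g : G, Isometry fun x : T => g • x) (g : G) : TreeHat T → TreeHat T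
  | Sum.inl x => Sum.inl (g • x)
  | Sum.inr ξ => Sum.inr <| Quotient.map'
      (fun r : Ray T => (⟨fun t => g • r.1 t, fun s t hs ht => by
        have h := (hiso g).dist_eq (r.1 s) (r.1 t)
        simpa using h.trans (r.2 s t hs ht)⟩ : Ray T))
      (fun r r' h => by
        obtain ⟨C, hC⟩ := h
        exact ⟨C, fun t ht => by
          have h' := (hiso g).dist_eq (r.1 t) (r'.1 t)
          simpa using h'.le.trans (hC t ht)⟩) ξ

/-! ### Laminations -/

/-- An algebraic lamination (as a set of pairs of boundary points) is closed by diagonal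
leaves. -/
def ClosedByDiagonal {ι : Type} (L : Set (InfWord ι × InfWord ι)) : Prop :=
  ∀ X X' X'' : InfWord ι, (X, X') ∈ L → (X', X'') ∈ L → X = X'' ∨ (X, X'') ∈ L

/-- Invariance of a lamination under the `F(𝒜)`-action on `∂²F(𝒜)`. -/
def InvariantLam {ι : Type} [DecidableEq ι] (L : Set (InfWord ι × InfWord ι)) : Prop :=
  ∀ (w : FreeGroup ι) (X X' Y Y' : InfWord ι), (X, X') ∈ L →
    SmulBoundary w X Y → SmulBoundary w X' Y' → (Y, Y') ∈ L

/-- Invariance of a lamination under the flip map. -/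
def FlipInvariant {ι : Type} (L : Set (InfWord ι × InfWord ι)) : Prop :=
  ∀ X Y : InfWord ι, (X, Y) ∈ L → (Y, X) ∈ L

/-- The dual lamination `L²(T)` is minimal up to diagonal leaves: it contains no proper
non-trivial sublamination that is closed by diagonal leaves. -/
def MinimalUpToDiagonal {ι : Type} [DecidableEq ι] (St : TreeSetup ι) : Prop :=
  ∀ L : Set (InfWord ι × InfWord ι), L ⊆ L2 St → L.Nonempty → IsClosed L →
    InvariantLam L → FlipInvariant L → ClosedByDiagonal L → L = L2 St

end CHL

namespace CHL

theorem IsRTree.mem_seg_or_mem_seg {T : Type*} [MetricSpace T] [IsRTree T] {x y z : T}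
    (c : T) (hz : z ∈ seg x y) : z ∈ seg x c ∨ z ∈ seg c y := by
  have hz' : dist x z + dist z y = dist x y := hz
  rcases le_max_iff.mp (IsRTree.four_point x y z c) with h | h
  · refine Or.inr (le_antisymm ?_ (dist_triangle c z y))
    linarith [dist_comm y c, dist_comm z c]
  · refine Or.inl (le_antisymm ?_ (dist_triangle x z c))
    linarith [dist_comm y z]

theorem seg_comm {T : Type*} [MetricSpace T] (x y : T) : seg x y = seg y x := by
  ext z
  simp only [seg, mem_ofPred_eq, dist_comm x, dist_comm _ y, add_comm (dist z x)]

theorem IsSubtree.union {T : Type*} [MetricSpace T] [IsRTree T] {B C : Set T}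
    (hB : IsSubtree B) (hC : IsSubtree C) (h : (B ∩ C).Nonempty) : IsSubtree (B ∪ C) := by
  obtain ⟨c, hcB, hcC⟩ := h
  have key : ∀ x ∈ B, ∀ y ∈ C, seg x y ⊆ B ∪ C := fun x hx y hy z hz =>
    (IsRTree.mem_seg_or_mem_seg c hz).imp (fun h => hB x hx c hcB h) (fun h => hC c hcC y hy h)
  rintro x (hx | hx) y (hy | hy)
  · exact (hB x hx y hy).trans subset_union_left
  · exact key x hx y hy
  · rw [seg_comm]
    exact key y hy x hx
  · exact (hC x hx y hy).trans subset_union_right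

theorem IsSubtree.biUnion_le {T : Type*} [MetricSpace T] [IsRTree T] {V : ℕ → Set T}
    (hV : ∀ j, IsSubtree (V j)) (h : ∀ j, (V j ∩ V (j + 1)).Nonempty) (n : ℕ) :
    IsSubtree (⋃ j ≤ n, V j) := by
  induction n with
  | zero => simpa using hV 0
  | succ n ih =>
    rw [biUnion_le_succ]
    obtain ⟨p, hp, hp'⟩ := h n
    exact ih.union (hV _) ⟨p, mem_biUnion (le_refl n) hp, hp'⟩

theorem IsRTree.exists_isPreconnected_subset_seg {T : Type*} [MetricSpace T] [IsRTree T]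
    (x y : T) : ∃ C ⊆ seg x y, IsPreconnected C ∧ x ∈ C ∧ y ∈ C := by
  obtain ⟨f, h0, h1, hf⟩ := IsRTree.geodesic x y
  have m0 : (0 : ℝ) ∈ Icc 0 (dist x y) := ⟨le_rfl, dist_nonneg⟩
  have m1 : dist x y ∈ Icc 0 (dist x y) := ⟨dist_nonneg, le_rfl⟩
  refine ⟨f '' Icc 0 (dist x y), ?_, isPreconnected_Icc.image f ?_, ⟨0, m0, h0⟩, ⟨_, m1, h1⟩⟩
  · rintro _ ⟨t, ht, rfl⟩
    have e0 := hf 0 m0 t ht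
    have e1 := hf t ht _ m1
    rw [h0, zero_sub, abs_neg, abs_of_nonneg ht.1] at e0
    rw [h1, abs_sub_comm, abs_of_nonneg (sub_nonneg.mpr ht.2)] at e1
    change _ + _ = _
    rw [e0, e1]
    ring
  · refine LipschitzOnWith.continuousOn (K := 1) (LipschitzOnWith.of_dist_le_mul ?_)
    intro s hs t ht
    rw [hf s hs t ht, NNReal.coe_one, one_mul, Real.dist_eq]

/-- In a chain of closed subtrees each of which separates the earlier ones from the later
ones, a segment from the first to the last member meets every member. -/
theorem IsRTree.seg_inter_nonempty_of_chain {T : Type*} [MetricSpace T] [IsRTree T]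
    {V : ℕ → Set T} (hV : ∀ j, IsSubtree (V j)) (hc : ∀ j, IsClosed (V j))
    (h : ∀ j, (V j ∩ V (j + 1)).Nonempty) {i n : ℕ} (hi : i ≤ n)
    (hsep : ∀ j ≤ i, ∀ k, i ≤ k → V j ∩ V k ⊆ V i)
    {x y : T} (hx : x ∈ V 0) (hy : y ∈ V n) : (seg x y ∩ V i).Nonempty := by
  obtain ⟨C, hCs, hC, hxC, hyC⟩ := IsRTree.exists_isPreconnected_subset_seg x y
  have hL : IsClosed (⋃ j ∈ Iic i, V j) := (finite_Iic i).isClosed_biUnion fun j _ => hc j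
  have hR : IsClosed (⋃ k ∈ Icc i n, V k) := (finite_Icc i n).isClosed_biUnion fun k _ => hc k
  have hcov : C ⊆ (⋃ j ∈ Iic i, V j) ∪ ⋃ k ∈ Icc i n, V k := by
    intro p hp
    have hp' := IsSubtree.biUnion_le hV h n x (mem_biUnion (Nat.zero_le n) hx) y
      (mem_biUnion (le_refl n) hy) (hCs hp)
    obtain ⟨j, hj, hpj⟩ := mem_iUnion₂.mp hp'
    rcases le_total j i with hji | hij
    · exact Or.inl (mem_biUnion (mem_Iic.mpr hji) hpj)
    · exact Or.inr (mem_biUnion (mem_Icc.mpr ⟨hij, hj⟩) hpj)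
  obtain ⟨p, hpC, hpL, hpR⟩ := isPreconnected_closed_iff.mp hC _ _ hL hR hcov
    ⟨x, hxC, mem_biUnion (mem_Iic.mpr (Nat.zero_le i)) hx⟩
    ⟨y, hyC, mem_biUnion (mem_Icc.mpr ⟨hi, le_rfl⟩) hy⟩
  obtain ⟨j, hj, hpj⟩ := mem_iUnion₂.mp hpL
  obtain ⟨k, hk, hpk⟩ := mem_iUnion₂.mp hpR
  exact ⟨p, hCs hpC, hsep j hj k hk.1 ⟨hpj, hpk⟩⟩

theorem IsSubtree.smul {G T : Type*} [Group G] [MetricSpace T] [MulAction G T]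
    (hiso : ∀ g : G, Isometry fun x : T => g • x) {B : Set T} (hB : IsSubtree B) (g : G) :
    IsSubtree (g • B) := by
  intro x hx y hy z hz
  rw [mem_smul_set_iff_inv_smul_mem] at hx hy ⊢
  refine hB _ hx _ hy ?_
  have hd := fun a b => (hiso g⁻¹).dist_eq a b
  change dist _ _ + dist _ _ = dist _ _
  rw [hd, hd, hd]
  exact hz

namespace SystemOfIsometries

section ChainDist

variable {K : Type*} [MetricSpace K] {ι : Type*} (S : SystemOfIsometries K ι)

theorem letterPE_isClosedSubtree (z : ι × Bool) : IsClosedSubtree (S.letterPE z).source := by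
  obtain ⟨i, _ | _⟩ := z
  exacts [S.target_subtree i, S.source_subtree i]

theorem dist_letterPE (z : ι × Bool) {x y : K} (hx : x ∈ (S.letterPE z).source)
    (hy : y ∈ (S.letterPE z).source) :
    dist (S.letterPE z x) (S.letterPE z y) = dist x y := by
  obtain ⟨i, _ | _⟩ := z
  · have h := S.isom i _ ((S.pe i).map_target hx) _ ((S.pe i).map_target hy)
    rw [(S.pe i).right_inv hx, (S.pe i).right_inv hy] at h
    exact h.symm
  · exact S.isom i x hx y hy

theorem letterPE_not (i : ι) (b : Bool) : S.letterPE (i, !b) = (S.letterPE (i, b)).symm := by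
  cases b <;> rfl

instance (z : ι × Bool) : Nonempty (S.letterPE z).source :=
  (S.letterPE_isClosedSubtree z).1.to_subtype

/-- The length of a shortest chain from `x` in `K` to `y` in the translate of `K` by the word
`L`, passing through the successive domains of the letters of `L`. -/
def chainDist : List (ι × Bool) → K → K → ℝ
  | [], x, y => dist x y
  | z :: L, x, y => ⨅ s : (S.letterPE z).source, dist x s + chainDist L (S.letterPE z s) y

theorem chainDist_nonneg (L : List (ι × Bool)) (x y : K) : 0 ≤ S.chainDist L x y := by
  induction L generalizing x with
  | nil => exact dist_nonneg
  | cons z L ih => exact Real.iInf_nonneg fun s => add_nonneg dist_nonneg (ih _)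

theorem chainDist_cons_le (z : ι × Bool) (L : List (ι × Bool)) (x y : K) {s : K}
    (hs : s ∈ (S.letterPE z).source) :
    S.chainDist (z :: L) x y ≤ dist x s + S.chainDist L (S.letterPE z s) y :=
  ciInf_le (f := fun s : (S.letterPE z).source =>
      dist x s + S.chainDist L (S.letterPE z s) y)
    ⟨0, by rintro _ ⟨s, rfl⟩; exact add_nonneg dist_nonneg (S.chainDist_nonneg _ _ _)⟩ ⟨s, hs⟩

theorem le_chainDist_cons {z : ι × Bool} {L : List (ι × Bool)} {x y : K} {c : ℝ}
    (h : ∀ s ∈ (S.letterPE z).source, c ≤ dist x s + S.chainDist L (S.letterPE z s) y) :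
    c ≤ S.chainDist (z :: L) x y :=
  le_ciInf fun s => h s s.2

theorem chainDist_le_dist_add (L : List (ι × Bool)) (x x' y : K) :
    S.chainDist L x y ≤ dist x x' + S.chainDist L x' y := by
  cases L with
  | nil => exact dist_triangle x x' y
  | cons z L =>
    rw [← sub_le_iff_le_add']
    refine S.le_chainDist_cons fun s hs => ?_
    linarith [S.chainDist_cons_le z L x y hs, dist_triangle x x' s]

theorem chainDist_append_le (L M : List (ι × Bool)) (x t y : K) :
    S.chainDist (L ++ M) x y ≤ S.chainDist L x t + S.chainDist M t y := by
  induction L generalizing x with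
  | nil => exact S.chainDist_le_dist_add M x t y
  | cons z L ih =>
    rw [← sub_le_iff_le_add]
    refine S.le_chainDist_cons fun s hs => ?_
    have h1 := S.chainDist_cons_le z (L ++ M) x y hs
    rw [List.cons_append]
    linarith [ih (S.letterPE z s)]

theorem chainDist_le_of_step {L M : List (ι × Bool)} (h : FreeGroup.Red.Step L M) (x y : K) :
    S.chainDist M x y ≤ S.chainDist L x y := by
  obtain @⟨L₁, L₂, i, b⟩ := h
  induction L₁ generalizing x with
  | nil =>
    refine S.le_chainDist_cons fun s hs => ?_
    rw [← sub_le_iff_le_add']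
    refine S.le_chainDist_cons fun t ht => ?_
    rw [letterPE_not] at ht ⊢
    have hd := S.dist_letterPE (i, b) hs ((S.letterPE (i, b)).map_target ht)
    rw [(S.letterPE (i, b)).right_inv ht] at hd
    rw [hd]
    have h1 := S.chainDist_le_dist_add L₂ x ((S.letterPE (i, b)).symm t) y
    have h2 := dist_triangle x s ((S.letterPE (i, b)).symm t)
    simp only [List.nil_append]
    linarith
  | cons z L₁ ih =>
    refine S.le_chainDist_cons fun s hs => ?_
    exact (S.chainDist_cons_le z _ x y hs).trans (by gcongr; exact ih _)

theorem chainDist_le_of_red {L M : List (ι × Bool)} (h : FreeGroup.Red L M) (x y : K) :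
    S.chainDist M x y ≤ S.chainDist L x y := by
  induction h with
  | refl => exact le_rfl
  | tail _ h ih => exact (S.chainDist_le_of_step h x y).trans ih

theorem chainDist_singleton_letterPE {z : ι × Bool} {x : K} (hx : x ∈ (S.letterPE z).source) :
    S.chainDist [z] x (S.letterPE z x) = 0 :=
  le_antisymm ((S.chainDist_cons_le z [] x _ hx).trans (by simp [chainDist]))
    (S.chainDist_nonneg _ _ _)

theorem mem_source_of_chainDist_cons_eq_zero [CompactSpace K] {z : ι × Bool}
    {L : List (ι × Bool)} {x y : K} (h : S.chainDist (z :: L) x y = 0) :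
    x ∈ (S.letterPE z).source ∧ S.chainDist L (S.letterPE z x) y = 0 := by
  have : CompactSpace (S.letterPE z).source :=
    isCompact_iff_compactSpace.mp (S.letterPE_isClosedSubtree z).2.1.isCompact
  have hz : Continuous fun s : (S.letterPE z).source => S.letterPE z s :=
    (Isometry.of_dist_eq (f := fun s : (S.letterPE z).source => S.letterPE z s)
      fun s t => S.dist_letterPE z s.2 t.2).continuous
  have hL : Continuous fun t => S.chainDist L t y :=
    (LipschitzWith.of_le_add fun t t' => by
      linarith [S.chainDist_le_dist_add L t t' y]).continuous
  have hsum : Continuous fun s : (S.letterPE z).source =>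
      dist x s + S.chainDist L (S.letterPE z s) y :=
    (continuous_const.dist continuous_subtype_val).add (hL.comp hz)
  obtain ⟨s, -, hs⟩ := isCompact_univ.exists_isMinOn univ_nonempty hsum.continuousOn
  have hle := S.le_chainDist_cons (L := L) (y := y) fun t ht => hs (mem_univ ⟨t, ht⟩)
  have h1 := S.chainDist_nonneg L (S.letterPE z s) y
  have h2 : 0 ≤ dist x s := dist_nonneg
  rw [h] at hle
  have hxs : x = s := dist_le_zero.mp (by linarith)
  exact hxs ▸ ⟨s.2, by linarith⟩

end ChainDist

section ChainSpace

/-- The disjoint union `F(𝒜) × K` of the translates of `K`, with the chain pseudometric. -/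
structure ChainSpace {K : Type*} [MetricSpace K] {ι : Type*} (S : SystemOfIsometries K ι) where
  word : FreeGroup ι
  point : K

variable {K : Type*} [MetricSpace K] {ι : Type*} (S : SystemOfIsometries K ι)

instance : MulAction (FreeGroup ι) S.ChainSpace where
  smul g p := ⟨g * p.word, p.point⟩
  one_smul p := congrArg (ChainSpace.mk · p.point) (one_mul p.word)
  mul_smul g h p := congrArg (ChainSpace.mk · p.point) (mul_assoc g h p.word)

theorem ChainSpace.smul_def (g : FreeGroup ι) (p : S.ChainSpace) :
    g • p = ⟨g * p.word, p.point⟩ := rfl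

/-- The inclusion of `K` as the base translate of the chain space. -/
def ChainSpace.base (x : K) : S.ChainSpace := ⟨1, x⟩

variable [DecidableEq ι]

theorem chainDist_toWord_mul_le (g h : FreeGroup ι) (x y t : K) :
    S.chainDist (g * h).toWord x y ≤ S.chainDist g.toWord x t + S.chainDist h.toWord t y := by
  rw [FreeGroup.toWord_mul]
  exact (S.chainDist_le_of_red FreeGroup.reduce.red x y).trans (S.chainDist_append_le _ _ x t y)

instance : PseudoMetricSpace S.ChainSpace where
  dist p q := max (S.chainDist (p.word⁻¹ * q.word).toWord p.point q.point)
    (S.chainDist (q.word⁻¹ * p.word).toWord q.point p.point)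
  dist_self p := by simp [chainDist]
  dist_comm p q := max_comm _ _
  dist_triangle p q r := by
    have h1 := S.chainDist_toWord_mul_le (p.word⁻¹ * q.word) (q.word⁻¹ * r.word) p.point r.point q.point
    have h2 := S.chainDist_toWord_mul_le (r.word⁻¹ * q.word) (q.word⁻¹ * p.word) r.point p.point q.point
    simp only [mul_assoc, mul_inv_cancel_left] at h1 h2
    refine max_le (h1.trans (add_le_add (le_max_left _ _) (le_max_left _ _))) ?_
    rw [add_comm]
    refine h2.trans (le_of_eq_of_le (add_comm _ _) (le_of_le_of_eq
      (add_le_add (le_max_right _ _) (le_max_right _ _)) (add_comm _ _)))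

theorem ChainSpace.dist_eq (p q : S.ChainSpace) :
    dist p q = max (S.chainDist (p.word⁻¹ * q.word).toWord p.point q.point)
      (S.chainDist (q.word⁻¹ * p.word).toWord q.point p.point) := rfl

instance : IsIsometricSMul (FreeGroup ι) S.ChainSpace where
  isometry_smul g := Isometry.of_dist_eq fun p q => by
    simp only [ChainSpace.dist_eq, ChainSpace.smul_def, mul_inv_rev, mul_assoc,
      inv_mul_cancel_left]

theorem ChainSpace.dist_base_smul_base (x y : K) (g : FreeGroup ι) :
    dist (base S x) (g • base S y) =
      max (S.chainDist g.toWord x y) (S.chainDist g⁻¹.toWord y x) := by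
  simp [ChainSpace.dist_eq, ChainSpace.smul_def, base]

theorem ChainSpace.dist_base (x y : K) : dist (base S x) (base S y) = dist x y := by
  simp [ChainSpace.dist_eq, base, chainDist, dist_comm y x]

theorem ChainSpace.dist_base_of_smul_base {i : ι} {x : K} (hx : x ∈ (S.pe i).source) :
    dist (base S x) (FreeGroup.of i • base S (S.pe i x)) = 0 := by
  rw [dist_base_smul_base]
  have h1 : S.chainDist [(i, true)] x (S.pe i x) = 0 :=
    S.chainDist_singleton_letterPE (z := (i, true)) hx
  have h2 := S.chainDist_singleton_letterPE (z := (i, false)) ((S.pe i).map_source hx)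
  change S.chainDist [(i, false)] (S.pe i x) ((S.pe i).symm (S.pe i x)) = 0 at h2
  rw [(S.pe i).left_inv hx] at h2
  have e : ((FreeGroup.of i)⁻¹).toWord = [(i, false)] := by
    rw [FreeGroup.toWord_inv, FreeGroup.toWord_of]
    rfl
  rw [FreeGroup.toWord_of, e, h1, h2, max_self]

end ChainSpace

end SystemOfIsometries

namespace AssocTree

open SystemOfIsometries

variable {K : Type} [MetricSpace K] {ι : Type} [DecidableEq ι] {S : SystemOfIsometries K ι}
  (A : AssocTree S)

theorem chainDist_eq_zero_of_emb_eq {g : FreeGroup ι} {x y : K}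
    (h : A.emb x = g • A.emb y) : S.chainDist g.toWord x y = 0 := by
  have hiso : ∀ g : FreeGroup ι,
      Isometry fun p : SeparationQuotient S.ChainSpace => g • p := by
    refine fun g => Isometry.of_dist_eq fun p q => ?_
    obtain ⟨p, rfl⟩ := SeparationQuotient.surjective_mk p
    obtain ⟨q, rfl⟩ := SeparationQuotient.surjective_mk q
    simp only [← SeparationQuotient.mk_smul, SeparationQuotient.dist_mk, dist_smul]
  obtain ⟨f, ⟨-, hf, hfe⟩, -⟩ := A.universal (SeparationQuotient S.ChainSpace) hiso
    (fun x => SeparationQuotient.mk (ChainSpace.base S x))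
    (Isometry.of_dist_eq fun x y => by
      rw [SeparationQuotient.dist_mk, ChainSpace.dist_base])
    (fun i x hx => by
      rw [inv_smul_eq_iff, ← dist_eq_zero, ← SeparationQuotient.mk_smul,
        SeparationQuotient.dist_mk, ChainSpace.dist_base_of_smul_base S hx])
  have hfx := congrArg f h
  rw [hf, hfe, hfe, ← dist_eq_zero, ← SeparationQuotient.mk_smul, SeparationQuotient.dist_mk,
    ChainSpace.dist_base_smul_base] at hfx
  exact le_antisymm (hfx ▸ le_max_left _ _) (S.chainDist_nonneg _ _ _)

theorem emb_eq_letter_smul {z : ι × Bool} {x : K} (hx : x ∈ (S.letterPE z).source) :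
    A.emb x = FreeGroup.mk [z] • A.emb (S.letterPE z x) := by
  obtain ⟨i, _ | _⟩ := z
  · have h := A.compat i _ ((S.pe i).map_target hx)
    rw [(S.pe i).right_inv hx] at h
    exact h.symm
  · exact inv_smul_eq_iff.mp (A.compat i x hx)

theorem emb_mem_smul_of_chainDist_eq_zero [CompactSpace K] {L : List (ι × Bool)} {x y : K}
    (h : S.chainDist L x y = 0) (n : ℕ) :
    A.emb x ∈ FreeGroup.mk (L.take n) • range A.emb := by
  induction L generalizing x n with
  | nil => simp [← FreeGroup.one_eq_mk]
  | cons z L ih =>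
    cases n with
    | zero => simp [← FreeGroup.one_eq_mk]
    | succ n =>
      obtain ⟨hx, h0⟩ := S.mem_source_of_chainDist_cons_eq_zero h
      rw [List.take_succ_cons, A.emb_eq_letter_smul hx, ← List.singleton_append,
        ← FreeGroup.mul_mk, mul_smul]
      exact smul_mem_smul_set (ih h0 n)

theorem gprefix_add (w : FreeGroup ι) (j m : ℕ) :
    gprefix w (j + m) = gprefix w j * FreeGroup.mk ((w.toWord.drop j).take m) := by
  rw [gprefix, gprefix, FreeGroup.mul_mk, List.take_add]

theorem gprefix_smul_inter_subset [CompactSpace K] (w : FreeGroup ι) {i j k : ℕ} (hji : j ≤ i)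
    (hik : i ≤ k) :
    gprefix w j • range A.emb ∩ gprefix w k • range A.emb ⊆ gprefix w i • range A.emb := by
  obtain ⟨m, rfl⟩ := Nat.exists_eq_add_of_le hji
  obtain ⟨l, rfl⟩ := Nat.exists_eq_add_of_le hik
  rintro _ ⟨⟨_, ⟨a, rfl⟩, rfl⟩, ⟨_, ⟨b, rfl⟩, hab⟩⟩
  change gprefix w (j + m + l) • A.emb b = gprefix w j • A.emb a at hab
  change gprefix w j • A.emb a ∈ _
  rw [add_assoc, gprefix_add, mul_smul, smul_left_cancel_iff] at hab
  have h0 := A.chainDist_eq_zero_of_emb_eq hab.symm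
  rw [FreeGroup.toWord_mk, FreeGroup.IsReduced.reduce_eq (FreeGroup.isReduced_toWord.infix
    ((List.take_prefix _ _).isInfix.trans (List.drop_suffix _ _).isInfix))] at h0
  have hmem := A.emb_mem_smul_of_chainDist_eq_zero h0 m
  rw [List.take_take, min_eq_left (Nat.le_add_right m l)] at hmem
  rw [gprefix_add, mul_smul]
  exact smul_mem_smul_set hmem

theorem gprefix_smul_inter_succ_nonempty [Nonempty K] (w : FreeGroup ι) (j : ℕ) :
    (gprefix w j • range A.emb ∩ gprefix w (j + 1) • range A.emb).Nonempty := by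
  rw [gprefix_add]
  rcases w.toWord.drop j with _ | ⟨z, L⟩
  · simpa [← FreeGroup.one_eq_mk] using range_nonempty A.emb
  · obtain ⟨x, hx⟩ := (S.letterPE_isClosedSubtree z).1
    refine ⟨gprefix w j • A.emb x, smul_mem_smul_set (mem_range_self x), ?_⟩
    rw [mul_smul, A.emb_eq_letter_smul hx]
    exact smul_mem_smul_set (smul_mem_smul_set (mem_range_self _))

theorem seg_inter_gprefix_smul_nonempty [CompactSpace K] (w : FreeGroup ι) {x x' : A.carrier}
    (hx : x ∈ range A.emb) (hx' : x' ∈ w • range A.emb) {i : ℕ} (hi : i ≤ w.toWord.length) :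
    (seg x x' ∩ gprefix w i • range A.emb).Nonempty := by
  have := A.tree
  have : Nonempty K := ⟨hx.choose⟩
  have hcomp : IsCompact (range A.emb) := isCompact_range A.emb_isom.continuous
  refine IsRTree.seg_inter_nonempty_of_chain (V := fun j => gprefix w j • range A.emb)
    (fun j => A.emb_subtree.smul A.act_isom _)
    (fun j => (hcomp.image (A.act_isom (gprefix w j)).continuous).isClosed)
    (A.gprefix_smul_inter_succ_nonempty w) hi
    (fun j hj k hk => A.gprefix_smul_inter_subset w hj hk) ?_ ?_
  · simpa [gprefix, ← FreeGroup.one_eq_mk] using hx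
  · simpa [gprefix, FreeGroup.mk_toWord] using hx'

end AssocTree

/-- **Lemma 3.7.**  (a) For every non-admissible word `w ∈ F(𝒜)`, the segment `[K, wK]`
joining the disjoint subtrees `K` and `wK` of `T_𝒦` intersects every prefix translate
`wᵢ K`.  (b) For every point `Q ∈ K` and every (possibly admissible) word `w ∈ F(𝒜)`, the
segment `[Q, wK]` intersects every prefix translate `wᵢ K`. -/
theorem bridge_meets_prefix_translates (K : Type) [MetricSpace K] [CompactSpace K]
    [IsRTree K] (ι : Type) [Fintype ι] [DecidableEq ι] (S : SystemOfIsometries K ι)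
    (A : AssocTree S) (w : FreeGroup ι) :
    ((¬ S.Admissible w) → ∀ x x' : A.carrier,
        IsBridge (Set.range A.emb) (w • Set.range A.emb) x x' →
        ∀ i ≤ w.toWord.length, (seg x x' ∩ gprefix w i • Set.range A.emb).Nonempty) ∧
    (∀ Q : K, ∀ x x' : A.carrier,
        IsBridge ({A.emb Q} : Set A.carrier) (w • Set.range A.emb) x x' →
        ∀ i ≤ w.toWord.length, (seg x x' ∩ gprefix w i • Set.range A.emb).Nonempty) := by
  refine ⟨fun _ x x' h i hi => A.seg_inter_gprefix_smul_nonempty w h.1 h.2.1 hi,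
    fun Q x x' h i hi => A.seg_inter_gprefix_smul_nonempty w ?_ h.2.1 hi⟩
  rw [mem_singleton_iff.mp h.1]
  exact mem_range_self Q

end CHL
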